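/- Let F be the free associative algebra over R = k[[ħ]] (k a field of characteristic zero) on generators x₁,x₂,x₃, and let c_{ij}^{pq} ∈ k with c_{ji}^{pq} = −c_{ij}^{pq} define y_{ij} = Σ_{p,q} c_{ij}^{pq} x_p∘x_q and v_i = Σ_{m,q} (c_{im}^{mq} + c_{im}^{qm}) x_q as above. Set f_{ij} = ħ·y_{ij} − (x_i x_j − x_j x_i) ∈ F. If v₁ = v₂ = v₃ = 0, then f₁₂x₃ + f₂₃x₁ + f₃₁x₂ = x₃f₁₂ + x₁f₂₃ + x₂f₃₁ in F. -/

import Mathlib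

open FreeAlgebra

/-- Jordan product `u ∘ v = (uv + vu)/2` in the free algebra over `k[[ħ]]`. -/
noncomputable def jordan {k : Type*} [Field k] [CharZero k]
    (u v : FreeAlgebra (PowerSeries k) (Fin 3)) : FreeAlgebra (PowerSeries k) (Fin 3) :=
  (PowerSeries.C (1/2 : k)) • (u * v + v * u)

/-- Contracting a cyclically invariant tensor with noncommutative cubic monomials is insensitive
to rotating the monomials. -/
theorem sum_smul_mul_rotate {ι R A : Type*} [Fintype ι] [CommSemiring R] [Semiring A]
    [Algebra R A] (T : ι → ι → ι → R) (hT : ∀ k p q, T q k p = T k p q) (x : ι → A) :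
    ∑ k, (∑ p, ∑ q, T k p q • (x p * x q)) * x k =
      ∑ k, x k * ∑ p, ∑ q, T k p q • (x p * x q) := by
  simp only [Finset.sum_mul, Finset.mul_sum, smul_mul_assoc, mul_smul_comm]
  rw [Finset.sum_comm]
  refine Finset.sum_congr rfl fun p _ => ?_
  rw [Finset.sum_comm]
  refine Finset.sum_congr rfl fun q _ => Finset.sum_congr rfl fun k _ => ?_
  rw [hT p q k, mul_assoc]

/-- The generators of a free algebra are linearly independent. -/
theorem coeff_eq_zero_of_sum_smul_ι_eq_zero {R X : Type*} [CommSemiring R] [Fintype X]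
    (a : X → R) (h : ∑ q, a q • ι R q = 0) (q : X) : a q = 0 := by
  classical
  simpa [Pi.single_apply] using congrArg (lift R (Pi.single q (1 : R))) h

/-- A quadratic element written with Jordan products, in terms of symmetrized coefficients. -/
theorem sum_smul_jordan {k : Type*} [Field k] [CharZero k] (d : Fin 3 → Fin 3 → k)
    (x : Fin 3 → FreeAlgebra (PowerSeries k) (Fin 3)) :
    ∑ p, ∑ q, PowerSeries.C (d p q) • jordan (x p) (x q) =
      ∑ p, ∑ q, PowerSeries.C ((d p q + d q p) / 2) • (x p * x q) := by
  have hswap : ∑ p, ∑ q, PowerSeries.C (d p q / 2) • (x q * x p) =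
      ∑ p, ∑ q, PowerSeries.C (d q p / 2) • (x p * x q) := Finset.sum_comm
  simp only [jordan, smul_smul, ← map_mul, mul_one_div, smul_add, Finset.sum_add_distrib,
    hswap, add_div, map_add, add_smul]

/-- If all divergences of a skew-symmetric family of quadratic coefficients vanish, the
symmetrized coefficients of the dual family are totally symmetric. -/
theorem symm_of_divergence_eq_zero {k : Type*} [Field k] [CharZero k]
    (c : Fin 3 → Fin 3 → Fin 3 → Fin 3 → k)
    (hskew : ∀ i j p q, c j i p q = - c i j p q)
    (hdiv : ∀ i q, ∑ m, (c i m m q + c i m q m) = 0) (l m q : Fin 3) :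
    c (l + 1) (l + 2) m q + c (l + 1) (l + 2) q m =
      c (m + 1) (m + 2) l q + c (m + 1) (m + 2) q l := by
  have hdiag (i p q) : c i i p q = 0 := self_eq_neg.mp (hskew i i p q)
  have h0 := hdiv 0 q
  have h1 := hdiv 1 q
  have h2 := hdiv 2 q
  simp only [Fin.sum_univ_three, hdiag] at h0 h1 h2
  have e10 := hskew 0 1
  have e20 := hskew 0 2
  have e21 := hskew 1 2
  fin_cases l <;> fin_cases m <;> simp <;> grind

theorem rank_zero_flatness_element {k : Type*} [Field k] [CharZero k]
    (c : Fin 3 → Fin 3 → Fin 3 → Fin 3 → k)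
    (hskew : ∀ i j p q, c j i p q = - c i j p q)
    -- the quadratic elements `y i j = ∑ c i j p q • (x p ∘ x q)`
    (y : Fin 3 → Fin 3 → FreeAlgebra (PowerSeries k) (Fin 3))
    (hy : ∀ i j, y i j = ∑ p, ∑ q,
        (PowerSeries.C (c i j p q)) • jordan (ι (PowerSeries k) p) (ι (PowerSeries k) q))
    -- the linear divergences `v i`
    (v : Fin 3 → FreeAlgebra (PowerSeries k) (Fin 3))
    (hv : ∀ i, v i = ∑ m, ∑ q,
        (PowerSeries.C (c i m m q + c i m q m)) • ι (PowerSeries k) q)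
    -- the defining relations `f i j = ħ y i j - [xᵢ, xⱼ]`
    (f : Fin 3 → Fin 3 → FreeAlgebra (PowerSeries k) (Fin 3))
    (hf : ∀ i j, f i j = (PowerSeries.X : PowerSeries k) • y i j -
        (ι (PowerSeries k) i * ι (PowerSeries k) j - ι (PowerSeries k) j * ι (PowerSeries k) i))
    (hv0 : ∀ i, v i = 0) :
    f 0 1 * ι (PowerSeries k) 2 + f 1 2 * ι (PowerSeries k) 0 + f 2 0 * ι (PowerSeries k) 1 =
      ι (PowerSeries k) 2 * f 0 1 + ι (PowerSeries k) 0 * f 1 2 +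
        ι (PowerSeries k) 1 * f 2 0 := by
  set x := ι (PowerSeries k) (X := Fin 3)
  have hdiv (i q) : ∑ m, (c i m m q + c i m q m) = 0 := by
    have h := (hv i).symm.trans (hv0 i)
    rw [Finset.sum_comm] at h
    simp only [← Finset.sum_smul, ← map_sum] at h
    exact (map_eq_zero_iff _ PowerSeries.C_injective).mp <|
      coeff_eq_zero_of_sum_smul_ι_eq_zero _ h q
  have hsymm := symm_of_divergence_eq_zero c hskew hdiv
  have hrot := sum_smul_mul_rotate
    (fun l p q => PowerSeries.C ((c (l + 1) (l + 2) p q + c (l + 1) (l + 2) q p) / 2))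
    (fun l p q => by rw [hsymm q l p, add_comm]) x
  simp only [← sum_smul_jordan, ← hy] at hrot
  simp only [Fin.sum_univ_three] at hrot
  change y 1 2 * x 0 + y 2 0 * x 1 + y 0 1 * x 2 =
    x 0 * y 1 2 + x 1 * y 2 0 + x 2 * y 0 1 at hrot
  have hħ := congrArg ((PowerSeries.X : PowerSeries k) • ·) hrot
  simp only [smul_add] at hħ
  simp only [hf, sub_mul, mul_sub, smul_mul_assoc, mul_smul_comm, mul_assoc]
  linear_combination (norm := abel) hħ
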